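/- Let n ≥ 8 and let G be a bicyclic graph with n vertices that is not isomorphic to B_n(n−1,3). Then χ(G) ≥ 4/√(n+1) + (n−5)/√n + 1, with equality if and only if G is isomorphic to B_{n,3}. -/

import Mathlib

open SimpleGraph

/-- The degree of a vertex (stated via `Set.ncard`, so no decidability assumptions). -/
noncomputable def degR {V : Type*} (G : SimpleGraph V) (v : V) : ℕ :=
  (G.neighborSet v).ncard

/-- The sum-connectivity index `χ(G) = ∑_{uv ∈ E(G)} 1/√(d_G(u)+d_G(v))`. -/
noncomputable def sumConn {V : Type*} [Fintype V] (G : SimpleGraph V) : ℝ :=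
  ∑ e ∈ G.edgeSet.toFinite.toFinset,
    Sym2.lift ⟨fun u v => (1 : ℝ) / Real.sqrt ((degR G u : ℝ) + (degR G v : ℝ)),
      fun u v => by simp [add_comm]⟩ e

/-- Vertex type of the graph `B_n(a,b)`. -/
def BabVert (a b : ℕ) : Type := Fin 4 ⊕ Fin (a - 3) ⊕ Fin (b - 3)

instance (a b : ℕ) : Fintype (BabVert a b) := by unfold BabVert; infer_instance

def BabRel (a b : ℕ) : BabVert a b → BabVert a b → Prop
  | Sum.inl i, Sum.inl j =>
      (i = 0 ∧ j = 1) ∨ (i = 0 ∧ j = 2) ∨ (i = 0 ∧ j = 3) ∨ (i = 1 ∧ j = 2) ∨ (i = 1 ∧ j = 3)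
  | Sum.inl i, Sum.inr (Sum.inl _) => i = 0
  | Sum.inl i, Sum.inr (Sum.inr _) => i = 1
  | _, _ => False

/-- The graph `B_n(a,b)` (where `a + b = n + 2`): the unique 4-vertex bicyclic graph
(`K₄` minus the edge between vertices `2` and `3`), with `a - 3` pendent vertices
attached to the degree-three vertex `0` and `b - 3` pendent vertices attached to
the degree-three vertex `1`. -/
def BabGraph (a b : ℕ) : SimpleGraph (BabVert a b) := SimpleGraph.fromRel (BabRel a b)

/-- Vertex type of the graph `B_{n,m}`. -/
def BnmVert (n m : ℕ) : Type := Unit ⊕ Fin 4 ⊕ Fin (n - 2 * m + 1) ⊕ (Fin (m - 3) × Fin 2)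

instance (n m : ℕ) : Fintype (BnmVert n m) := by unfold BnmVert; infer_instance

def BnmRel (n m : ℕ) : BnmVert n m → BnmVert n m → Prop
  | Sum.inl _, Sum.inr (Sum.inl _) => True
  | Sum.inl _, Sum.inr (Sum.inr (Sum.inl _)) => True
  | Sum.inl _, Sum.inr (Sum.inr (Sum.inr (_, j))) => j = 0
  | Sum.inr (Sum.inl i), Sum.inr (Sum.inl i') => (i = 0 ∧ i' = 1) ∨ (i = 2 ∧ i' = 3)
  | Sum.inr (Sum.inr (Sum.inr (k, j))), Sum.inr (Sum.inr (Sum.inr (k', j'))) =>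
      k = k' ∧ j = 0 ∧ j' = 1
  | _, _ => False

/-- The graph `B_{n,m}`: two triangles sharing a common vertex (`Sum.inl ()`), with
`n - 2m + 1` pendent vertices and `m - 3` paths on two vertices attached to the
common vertex. -/
def BnmGraph (n m : ℕ) : SimpleGraph (BnmVert n m) := SimpleGraph.fromRel (BnmRel n m)

/-- The sum-connectivity index of `B_{n,3}`. -/
noncomputable def secondMin (n : ℕ) : ℝ :=
  4 / Real.sqrt ((n : ℝ) + 1) + ((n : ℝ) - 5) / Real.sqrt (n : ℝ) + 1

lemma secondMin_le {n : ℕ} (hn : 0 < n) : secondMin n ≤ √n + 1 - 1 / √n := by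
  have hn' : (0 : ℝ) < n := by exact_mod_cast hn
  have h : 4 / √((n : ℝ) + 1) ≤ 4 / √n := by gcongr; linarith
  have h' : √(n : ℝ) + 1 - 1 / √n = 4 / √n + (n - 5) / √n + 1 := by
    have := Real.sqrt_pos.2 hn'
    field_simp
    linarith [Real.mul_self_sqrt hn'.le]
  rw [h', secondMin]
  linarith

lemma sq_secondMin_le {n : ℕ} (hn : 5 ≤ n) : secondMin n ^ 2 ≤ n + 2 * √n - 1 := by
  have hn' : (5 : ℝ) ≤ n := by exact_mod_cast hn
  have h0 : 0 ≤ secondMin n := by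
    have : 0 ≤ ((n : ℝ) - 5) / √n := div_nonneg (by linarith) (Real.sqrt_nonneg _)
    rw [secondMin]; positivity
  have hr := Real.sqrt_pos.2 (show (0 : ℝ) < n by linarith)
  have hr2 := Real.sq_sqrt (show (0 : ℝ) ≤ n by linarith)
  refine (pow_le_pow_left₀ h0 (secondMin_le (by omega)) 2).trans ?_
  have h1 : √(n : ℝ) * (1 / √n) = 1 := mul_one_div_cancel hr.ne'
  have h2 : 0 < 1 / √(n : ℝ) := by positivity
  have h3 : 1 / √(n : ℝ) ≤ 1 := by
    rw [div_le_one hr]; exact Real.one_le_sqrt.2 (by linarith)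
  nlinarith

lemma secondMin_small :
    secondMin 8 < 3.3941 ∧ secondMin 9 < 3.5983 ∧ secondMin 10 < 3.7873 ∧
      secondMin 11 < 4.0152 ∧ secondMin 12 < 4.1755 ∧ secondMin 13 < 4.3283 := by
  have aux : ∀ (n : ℕ) (a b : ℝ), 5 ≤ n → 0 < a → 0 < b → 1 ≤ a ^ 2 * (n + 1) → 1 ≤ b ^ 2 * n →
      secondMin n ≤ 4 * a + (n - 5) * b + 1 := by
    intro n a b hn ha hb h1 h2
    have hn' : (5 : ℝ) ≤ n := by exact_mod_cast hn
    have h3 : 4 / √((n : ℝ) + 1) ≤ 4 * a := by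
      rw [div_le_iff₀ (Real.sqrt_pos.2 (by linarith)), mul_assoc]
      have : 1 / a ≤ √((n : ℝ) + 1) := Real.le_sqrt_of_sq_le (by
        rw [div_pow, one_pow, div_le_iff₀ (by positivity)]; linarith)
      rw [div_le_iff₀ ha] at this
      linarith
    have h4 : ((n : ℝ) - 5) / √n ≤ (n - 5) * b := by
      rw [div_le_iff₀ (Real.sqrt_pos.2 (by linarith)), mul_assoc]
      have : 1 / b ≤ √(n : ℝ) := Real.le_sqrt_of_sq_le (by
        rw [div_pow, one_pow, div_le_iff₀ (by positivity)]; linarith)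
      rw [div_le_iff₀ hb] at this
      nlinarith
    rw [secondMin]; linarith
  refine ⟨(aux 8 0.33334 0.353556 ?_ ?_ ?_ ?_ ?_).trans_lt ?_,
    (aux 9 0.316229 0.333334 ?_ ?_ ?_ ?_ ?_).trans_lt ?_,
    (aux 10 0.301512 0.316229 ?_ ?_ ?_ ?_ ?_).trans_lt ?_,
    (aux 11 0.288676 0.301512 ?_ ?_ ?_ ?_ ?_).trans_lt ?_,
    (aux 12 0.277351 0.288676 ?_ ?_ ?_ ?_ ?_).trans_lt ?_,
    (aux 13 0.267262 0.277351 ?_ ?_ ?_ ?_ ?_).trans_lt ?_⟩ <;> norm_num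

lemma lt_sqrt_add_sqrt {c b x y : ℝ} (hx : (c - b) ^ 2 ≤ x)
    (hy : b ^ 2 ≤ y) : c ≤ √x + √y := by
  have h1 : c - b ≤ √x := Real.le_sqrt_of_sq_le hx
  have h2 : b ≤ √y := Real.le_sqrt_of_sq_le hy
  linarith

/-- The right-hand side bounds the index from below when the maximum degree is at most `D`; see
`sqrt_le_sumConn_of_degree_le`. -/
lemma secondMin_lt_of_two_mul_le {n D : ℕ} (hn : 8 ≤ n) (hD : 2 * D ≤ n) :
    secondMin n < √(((n : ℝ) + 1) ^ 3 / ((D + 2) * n + 2 * D + 2)) := by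
  have hn' : (8 : ℝ) ≤ n := by exact_mod_cast hn
  have hD' : 2 * (D : ℝ) ≤ n := by exact_mod_cast hD
  have hmono : ((n : ℝ) + 1) ^ 3 / ((n / 2 + 2) * n + n + 2) ≤
      ((n : ℝ) + 1) ^ 3 / ((D + 2) * n + 2 * D + 2) := by
    have : (0 : ℝ) < (D + 2) * n + 2 * D + 2 := by positivity
    gcongr
    linarith
  refine lt_of_lt_of_le ?_ (Real.sqrt_le_sqrt hmono)
  obtain h | h := lt_or_ge n 11
  · obtain ⟨h8, h9, h10, -⟩ := secondMin_small
    interval_cases n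
    · exact h8.trans_le (Real.le_sqrt_of_sq_le (by norm_num))
    · exact h9.trans_le (Real.le_sqrt_of_sq_le (by norm_num))
    · exact h10.trans_le (Real.le_sqrt_of_sq_le (by norm_num))
  · have h11 : (11 : ℝ) ≤ n := by exact_mod_cast h
    refine Real.lt_sqrt_of_sq_lt ?_
    refine (sq_secondMin_le (by omega)).trans_lt ?_
    rw [lt_div_iff₀ (by positivity)]
    have h2 : 2 * √(n : ℝ) ≤ n / 4 + 4 := by
      nlinarith [sq_nonneg (√(n : ℝ) / 2 - 2), Real.sq_sqrt (show (0 : ℝ) ≤ n by linarith)]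
    have h3 : ((n : ℝ) + 2 * √n - 1) * ((n / 2 + 2) * n + n + 2) ≤
        (5 / 4 * n + 3) * ((n / 2 + 2) * n + n + 2) := by gcongr; linarith
    nlinarith [mul_nonneg (sub_nonneg.2 h11) (sub_nonneg.2 h11),
      mul_nonneg (mul_nonneg (sub_nonneg.2 h11) (sub_nonneg.2 h11)) (sub_nonneg.2 h11)]

/-- The two square roots bound the contributions of the edges at a vertex of degree `d` and of the
remaining edges; see `sqrt_add_sqrt_le_sumConn`. -/
lemma secondMin_lt_of_lt_two_mul {n d : ℕ} (hn : 8 ≤ n) (hd : n < 2 * d) (hdn : d + 2 ≤ n) :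
    secondMin n < √((d : ℝ) ^ 3 / (d ^ 2 + n + 3)) +
      √(((n : ℝ) + 1 - d) ^ 3 / ((n + 1 - d) ^ 2 + 2 * (n + 1 - d) + 2)) := by
  obtain h | h := lt_or_ge n 14
  · obtain ⟨h8, h9, h10, h11, h12, h13⟩ := secondMin_small
    obtain ⟨q, hq⟩ : ∃ q, n + 1 = d + q := ⟨n + 1 - d, by omega⟩
    have hq' : (n : ℝ) + 1 - d = q := by
      rw [sub_eq_iff_eq_add]; exact_mod_cast hq.trans (add_comm _ _)
    rw [hq']
    have hq3 : 3 ≤ q := by omega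
    have hq7 : q ≤ 7 := by omega
    obtain ⟨b, hb, hb'⟩ : ∃ b : ℝ, b ^ 2 ≤ (q : ℝ) ^ 3 / (q ^ 2 + 2 * q + 2) ∧
        (b = if q = 3 then 1.26 else if q = 4 then 1.568 else if q = 5 then 1.837 else
          if q = 6 then 2.078 else 2.297) := by
      interval_cases q <;> refine ⟨_, ?_, rfl⟩ <;> norm_num
    interval_cases n <;> interval_cases q <;>
      first
        | omega
        | (obtain rfl : d = _ := (Nat.eq_sub_of_add_eq hq.symm))
          norm_num at hb'
          subst hb'
          first
          | refine h8.trans_le (lt_sqrt_add_sqrt ?_ hb)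
          | refine h9.trans_le (lt_sqrt_add_sqrt ?_ hb)
          | refine h10.trans_le (lt_sqrt_add_sqrt ?_ hb)
          | refine h11.trans_le (lt_sqrt_add_sqrt ?_ hb)
          | refine h12.trans_le (lt_sqrt_add_sqrt ?_ hb)
          | refine h13.trans_le (lt_sqrt_add_sqrt ?_ hb)
          norm_num
  · have h14 : (14 : ℝ) ≤ n := by exact_mod_cast h
    have hr := Real.sqrt_nonneg (n : ℝ)
    have hr2 := Real.sq_sqrt (show (0 : ℝ) ≤ n by linarith)
    have hr3 : (3.74 : ℝ) ≤ √n := Real.le_sqrt_of_sq_le (by norm_num; linarith)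
    have key : ∀ {x y s : ℝ}, 0 ≤ x → 0 ≤ y → 0 ≤ s → (n : ℝ) + 2 * √n - 1 < x + y + 2 * s →
        s ^ 2 ≤ x * y → secondMin n < √x + √y := by
      intro x y s hx hy hs h1 h2
      have h3 : s ≤ √x * √y := by
        rw [← Real.sqrt_mul hx]; exact Real.le_sqrt_of_sq_le h2
      refine lt_of_pow_lt_pow_left₀ 2 (by positivity) ((sq_secondMin_le (by omega)).trans_lt ?_)
      nlinarith [Real.sq_sqrt hx, Real.sq_sqrt hy]
    have hd' : (n : ℝ) + 1 ≤ 2 * d := by exact_mod_cast hd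
    obtain hq | hq | hq : d + 2 = n ∨ d + 3 = n ∨ d + 4 ≤ n := by omega
    · have hdn' : (d : ℝ) = n - 2 := by rw [← hq]; push_cast; ring
      refine (secondMin_le (by omega)).trans_lt ?_
      have hy : ((n : ℝ) + 1 - d) ^ 3 / ((n + 1 - d) ^ 2 + 2 * (n + 1 - d) + 2) = 27 / 17 := by
        rw [hdn']; norm_num
      have hy' : (1.26 : ℝ) ≤ √(27 / 17) := Real.le_sqrt_of_sq_le (by norm_num)
      have ht : √(n : ℝ) * (1 / √n) = 1 := mul_one_div_cancel (by positivity)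
      have ht0 : 0 < 1 / √(n : ℝ) := by positivity
      have ht1 : 1 / √(n : ℝ) ≤ 0.268 := by
        rw [div_le_iff₀ (by positivity)]; linarith
      have hx : (n : ℝ) - 3 - 4 * (1 / √n) ^ 2 ≤ (d : ℝ) ^ 3 / (d ^ 2 + n + 3) := by
        rw [div_pow, hr2, le_div_iff₀ (by positivity), hdn']
        field_simp
        nlinarith
      have hx' : √n - 0.26 - 1 / √n < √((d : ℝ) ^ 3 / (d ^ 2 + n + 3)) := by
        refine Real.lt_sqrt_of_sq_lt (lt_of_lt_of_le ?_ hx)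
        nlinarith
      rw [hy]
      linarith
    · have hdn' : (d : ℝ) = n - 3 := by rw [← hq]; push_cast; ring
      have hx : (n : ℝ) - 4.4 ≤ (d : ℝ) ^ 3 / (d ^ 2 + n + 3) := by
        rw [le_div_iff₀ (by positivity), hdn']; nlinarith
      have hy : ((n : ℝ) + 1 - d) ^ 3 / ((n + 1 - d) ^ 2 + 2 * (n + 1 - d) + 2) = 32 / 13 := by
        rw [hdn']; norm_num
      rw [hy]
      refine key (s := √n + 0.7) (by positivity) (by norm_num) (by positivity) (by linarith) ?_
      nlinarith
    · have hdn' : (d : ℝ) + 4 ≤ n := by exact_mod_cast hq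
      have hx : (d : ℝ) - 2 ≤ (d : ℝ) ^ 3 / (d ^ 2 + n + 3) := by
        rw [le_div_iff₀ (by positivity)]; nlinarith
      obtain ⟨q, hq⟩ : ∃ q : ℝ, q = n + 1 - d := ⟨_, rfl⟩
      rw [← hq]
      have hq5 : 5 ≤ q := by linarith
      have hy : q - 2 < q ^ 3 / (q ^ 2 + 2 * q + 2) := by
        rw [lt_div_iff₀ (by positivity)]; nlinarith
      refine key (s := √n + 1) (by positivity) (by positivity) (by positivity) (by linarith) ?_
      refine le_trans ?_ (mul_le_mul hx hy.le (by linarith) (by positivity))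
      rw [show (d : ℝ) = n + 1 - q by linarith]
      nlinarith [mul_nonneg (sub_nonneg.2 hq5) (show 0 ≤ ((n : ℝ) + 1) / 2 - q by linarith)]

/-- The sum over an edge of the values of a function at its two ends. -/
def endSum {V : Type*} (f : V → ℝ) : Sym2 V → ℝ :=
  Sym2.lift ⟨fun u v => f u + f v, fun _ _ => add_comm _ _⟩

@[simp] lemma endSum_mk {V : Type*} (f : V → ℝ) (u v : V) : endSum f s(u, v) = f u + f v := rfl

lemma degR_eq_degree {V : Type*} [Fintype V] (G : SimpleGraph V) [DecidableRel G.Adj] (v : V) :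
    degR G v = G.degree v := by
  rw [degR, Set.ncard_eq_toFinset_card', ← card_neighborFinset_eq_degree, neighborFinset]

lemma sumConn_eq_sum_edgeFinset {V : Type*} [Fintype V] (G : SimpleGraph V)
    [DecidableRel G.Adj] :
    sumConn G = ∑ e ∈ G.edgeFinset, 1 / √(endSum (fun v => (G.degree v : ℝ)) e) := by
  rw [sumConn]
  refine Finset.sum_congr (by ext; simp) fun e _ => ?_
  induction e with
  | _ u v => simp [degR_eq_degree]

lemma endSum_degree_pos {V : Type*} [Fintype V] (G : SimpleGraph V) [DecidableRel G.Adj]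
    {e : Sym2 V} (he : e ∈ G.edgeFinset) :
    0 < endSum (fun v => (G.degree v : ℝ)) e := by
  induction e with
  | _ u v =>
    have huv : G.Adj u v := mem_edgeFinset.1 he
    have hu : 0 < G.degree u := (G.degree_pos_iff_exists_adj u).2 ⟨v, huv⟩
    rw [endSum_mk]
    positivity

section

variable {V : Type*} [Fintype V] [DecidableEq V] (G : SimpleGraph V) [DecidableRel G.Adj]

lemma sum_edgeFinset_endSum (f : V → ℝ) :
    ∑ e ∈ G.edgeFinset, endSum f e = ∑ v, G.degree v * f v := by
  have h : ∀ e ∈ G.edgeFinset, endSum f e = ∑ v, if v ∈ e then f v else 0 := by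
    intro e he
    induction e with
    | _ u v =>
      have huv : u ≠ v := (mem_edgeFinset.1 he : G.Adj u v).ne
      rw [← Finset.sum_filter, show Finset.univ.filter (· ∈ s(u, v)) = {u, v} by ext; simp,
        Finset.sum_pair huv, endSum_mk]
  rw [Finset.sum_congr rfl h, Finset.sum_comm]
  refine Finset.sum_congr rfl fun v _ => ?_
  rw [← Finset.sum_filter, Finset.sum_const, nsmul_eq_mul, ← incidenceFinset_eq_filter,
    card_incidenceFinset_eq_degree]

lemma degree_add_degree_le_card_edgeFinset {u v : V} (h : G.Adj u v) :
    G.degree u + G.degree v ≤ G.edgeFinset.card + 1 := by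
  rw [← card_incidenceFinset_eq_degree, ← card_incidenceFinset_eq_degree,
    ← Finset.card_union_add_card_inter]
  refine add_le_add (Finset.card_le_card
    (Finset.union_subset (G.incidenceFinset_subset u) (G.incidenceFinset_subset v))) ?_
  rw [← Finset.card_singleton s(u, v)]
  refine Finset.card_le_card fun e he => ?_
  have := G.incidenceSet_inter_incidenceSet_subset h.ne
    (show e ∈ G.incidenceSet u ∩ G.incidenceSet v by simpa using he)
  simpa using this

lemma sum_incidenceFinset {M : Type*} [AddCommMonoid M] (w : V) (F : Sym2 V → M) :
    ∑ e ∈ G.incidenceFinset w, F e = ∑ v ∈ G.neighborFinset w, F s(w, v) := by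
  rw [← Finset.sum_image (f := F) (g := fun v => s(w, v))]
  · refine Finset.sum_congr ?_ fun _ _ => rfl
    ext e
    induction e with
    | _ u v =>
      simp only [mem_incidenceFinset, mk'_mem_incidenceSet_iff, Finset.mem_image,
        mem_neighborFinset, Sym2.eq_iff]
      grind [SimpleGraph.adj_comm]
  · intro u _ v _ h
    exact Sym2.congr_right.1 h

lemma sum_edgeFinset_eq_add {M : Type*} [AddCommMonoid M] (w : V) (F : Sym2 V → M) :
    ∑ e ∈ G.edgeFinset, F e = ∑ v ∈ G.neighborFinset w, F s(w, v) +
      ∑ e ∈ (G.deleteIncidenceSet w).edgeFinset, F e := by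
  rw [← sum_incidenceFinset, edgeFinset_deleteIncidenceSet_eq_sdiff, add_comm,
    Finset.sum_sdiff (G.incidenceFinset_subset w)]

lemma degree_deleteIncidenceSet_self (w : V) : (G.deleteIncidenceSet w).degree w = 0 := by
  rw [← card_neighborFinset_eq_degree, Finset.card_eq_zero]
  ext v
  simp [deleteIncidenceSet_adj]

lemma degree_deleteIncidenceSet_add {v w : V} (h : v ≠ w) :
    (G.deleteIncidenceSet w).degree v + (if G.Adj w v then 1 else 0) = G.degree v := by
  have hN : (G.deleteIncidenceSet w).neighborFinset v = (G.neighborFinset v).erase w := by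
    ext u
    simp only [mem_neighborFinset, deleteIncidenceSet_adj, Finset.mem_erase]
    tauto
  rw [← card_neighborFinset_eq_degree, ← card_neighborFinset_eq_degree, hN]
  split_ifs with hvw
  · exact Finset.card_erase_add_one (by simpa using hvw.symm)
  · rw [Finset.erase_eq_of_notMem (by simpa [adj_comm] using hvw), add_zero]

end

/-- Jensen's inequality for `s ↦ 1 / √s`. -/
lemma sqrt_le_sum_one_div_sqrt {ι : Type*} (S : Finset ι) (s : ι → ℝ) {A : ℝ} (hS : S.Nonempty)
    (hs : ∀ i ∈ S, 0 < s i) (hA : ∑ i ∈ S, s i ≤ A) :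
    √((S.card : ℝ) ^ 3 / A) ≤ ∑ i ∈ S, 1 / √(s i) := by
  have hm : (0 : ℝ) < S.card := by exact_mod_cast hS.card_pos
  have hA0 : 0 < A := (Finset.sum_pos hs hS).trans_le hA
  set b := √(A / S.card) with hb
  have hb0 : 0 < b := Real.sqrt_pos.2 (by positivity)
  have hb2 : b ^ 2 * S.card = A := by
    rw [hb, Real.sq_sqrt (by positivity)]; field_simp
  have hmb : √((S.card : ℝ) ^ 3 / A) = S.card / b := by
    rw [← hb2, show (S.card : ℝ) ^ 3 / (b ^ 2 * S.card) = (S.card / b) ^ 2 by field_simp,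
      Real.sqrt_sq (by positivity)]
  have tangent : ∀ i ∈ S, (3 * b ^ 2 - s i) / (2 * b ^ 3) ≤ 1 / √(s i) := by
    intro i hi
    have ht := Real.sqrt_pos.2 (hs i hi)
    rw [div_le_div_iff₀ (by positivity) ht, ← Real.sq_sqrt (hs i hi).le, Real.sqrt_sq ht.le]
    nlinarith [mul_nonneg (sq_nonneg (b - √(s i))) (show 0 ≤ 2 * b + √(s i) by positivity)]
  rw [hmb]
  refine le_trans ?_ (Finset.sum_le_sum tangent)
  rw [← Finset.sum_div, Finset.sum_sub_distrib, Finset.sum_const, nsmul_eq_mul,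
    div_le_div_iff₀ hb0 (by positivity)]
  nlinarith [mul_le_mul_of_nonneg_left hA hb0.le]

section

variable {V : Type*} [Fintype V] [DecidableEq V] (G : SimpleGraph V) [DecidableRel G.Adj] {n : ℕ}

lemma sqrt_le_sumConn_of_degree_le (hcard : Fintype.card V = n) (hedges : G.edgeFinset.card = n + 1)
    (hpos : ∀ v, 0 < G.degree v) {D : ℕ} (hD : ∀ v, G.degree v ≤ D) :
    √(((n : ℝ) + 1) ^ 3 / ((D + 2) * n + 2 * D + 2)) ≤ sumConn G := by
  rw [sumConn_eq_sum_edgeFinset]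
  have h := sqrt_le_sum_one_div_sqrt G.edgeFinset (endSum fun v => (G.degree v : ℝ))
    (A := (D + 2) * n + 2 * D + 2) (Finset.card_pos.1 (by omega))
    (fun e he => endSum_degree_pos G he) ?_
  · rwa [hedges, Nat.cast_succ] at h
  rw [sum_edgeFinset_endSum]
  have hsum : (∑ v, (G.degree v : ℝ)) = 2 * (n + 1) := by
    exact_mod_cast (G.sum_degrees_eq_twice_card_edges).trans (by rw [hedges])
  calc ∑ v, (G.degree v : ℝ) * G.degree v ≤ ∑ v, ((D + 1) * (G.degree v : ℝ) - D) := by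
        refine Finset.sum_le_sum fun v _ => ?_
        have h1 : (1 : ℝ) ≤ G.degree v := by exact_mod_cast hpos v
        have h2 : (G.degree v : ℝ) ≤ D := by exact_mod_cast hD v
        nlinarith
    _ = (D + 2) * n + 2 * D + 2 := by
        rw [Finset.sum_sub_distrib, ← Finset.mul_sum, hsum]
        simp [hcard]
        ring

lemma sum_neighborFinset_degree_le (hcard : Fintype.card V = n)
    (hedges : G.edgeFinset.card = n + 1) (hpos : ∀ v, 0 < G.degree v) (w : V) :
    ∑ v ∈ G.neighborFinset w, (G.degree v : ℝ) ≤ n + 3 := by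
  have hsum : ∑ v, G.degree v = 2 * (n + 1) := by rw [G.sum_degrees_eq_twice_card_edges, hedges]
  have h1 : ((insert w (G.neighborFinset w))ᶜ).card ≤
      ∑ v ∈ (insert w (G.neighborFinset w))ᶜ, G.degree v := by
    rw [Finset.card_eq_sum_ones]
    exact Finset.sum_le_sum fun v _ => hpos v
  have hw : w ∉ G.neighborFinset w := by simp
  rw [Finset.card_compl, Finset.card_insert_of_notMem hw, card_neighborFinset_eq_degree,
    hcard] at h1
  rw [← Finset.sum_add_sum_compl (insert w (G.neighborFinset w)), Finset.sum_insert hw] at hsum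
  have : ∑ v ∈ G.neighborFinset w, G.degree v ≤ n + 3 := by omega
  exact_mod_cast this

lemma sqrt_add_sqrt_le_sumConn (hcard : Fintype.card V = n)
    (hedges : G.edgeFinset.card = n + 1) (hpos : ∀ v, 0 < G.degree v) {w : V} {d : ℕ}
    (hd : G.degree w = d) :
    √((d : ℝ) ^ 3 / (d ^ 2 + n + 3)) +
      √(((n : ℝ) + 1 - d) ^ 3 / ((n + 1 - d) ^ 2 + 2 * (n + 1 - d) + 2)) ≤ sumConn G := by
  have hdn : d < n := hd ▸ hcard ▸ G.degree_lt_card_verts w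
  have hN := sum_neighborFinset_degree_le G hcard hedges hpos w
  let H := G.deleteIncidenceSet w
  have hq : H.edgeFinset.card = n + 1 - d := by
    rw [card_edgeFinset_deleteIncidenceSet, hedges, hd]
  have hq' : (H.edgeFinset.card : ℝ) = n + 1 - d := by
    rw [hq, Nat.cast_sub (by omega)]; push_cast; ring
  have hHG : H ≤ G := G.deleteIncidenceSet_le w
  rw [sumConn_eq_sum_edgeFinset, sum_edgeFinset_eq_add G w]
  refine add_le_add ?_ ?_
  · rw [← hd, ← card_neighborFinset_eq_degree]
    refine sqrt_le_sum_one_div_sqrt _ _ ?_ (fun v hv => ?_) ?_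
    · rw [← Finset.card_pos, card_neighborFinset_eq_degree]; exact hpos w
    · exact endSum_degree_pos G (by simpa using hv)
    · simp only [endSum_mk, Finset.sum_add_distrib, Finset.sum_const, nsmul_eq_mul,
        card_neighborFinset_eq_degree]
      linarith
  · rw [← hq']
    refine sqrt_le_sum_one_div_sqrt _ _ (Finset.card_pos.1 (by omega))
      (fun e he => endSum_degree_pos G (edgeFinset_mono hHG he)) ?_
    let ε : V → ℝ := fun v => if G.Adj w v then 1 else 0
    have hle : ∀ e ∈ H.edgeFinset, endSum (fun v => (G.degree v : ℝ)) e ≤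
        (H.edgeFinset.card + 1) + endSum ε e := by
      intro e he
      induction e with
      | _ u v =>
        have huv : H.Adj u v := mem_edgeFinset.1 he
        have h1 : (H.degree u : ℝ) + H.degree v ≤ H.edgeFinset.card + 1 := by
          exact_mod_cast degree_add_degree_le_card_edgeFinset H huv
        obtain ⟨-, hu, hv⟩ := deleteIncidenceSet_adj.1 huv
        have h2 : (H.degree u : ℝ) + ε u = G.degree u := by
          simpa [ε] using congrArg (Nat.cast (R := ℝ)) (degree_deleteIncidenceSet_add G hu)
        have h3 : (H.degree v : ℝ) + ε v = G.degree v := by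
          simpa [ε] using congrArg (Nat.cast (R := ℝ)) (degree_deleteIncidenceSet_add G hv)
        simp only [endSum_mk]
        linarith
    have hε : ∑ e ∈ H.edgeFinset, endSum ε e ≤ n + 3 - d := by
      have h1 : ∑ v, (H.degree v : ℝ) * ε v = ∑ v ∈ G.neighborFinset w, ((G.degree v : ℝ) - 1) := by
        simp only [ε, mul_ite, mul_one, mul_zero]
        rw [← Finset.sum_filter, ← neighborFinset_eq_filter]
        refine Finset.sum_congr rfl fun v hv => ?_
        have hwv : G.Adj w v := by simpa using hv
        rw [← degree_deleteIncidenceSet_add G hwv.ne', if_pos hwv]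
        push_cast
        ring
      rw [sum_edgeFinset_endSum, h1, Finset.sum_sub_distrib, Finset.sum_const, nsmul_eq_mul,
        card_neighborFinset_eq_degree, hd]
      linarith
    refine (Finset.sum_le_sum hle).trans ?_
    rw [Finset.sum_add_distrib, Finset.sum_const, nsmul_eq_mul]
    rw [hq'] at *
    nlinarith

end

lemma exists_equiv_extending_pair {ι V W : Type*} [Finite ι] [Fintype V] [Fintype W]
    (hcard : Fintype.card V = Fintype.card W) {f : ι → V} {g : ι → W} (hf : f.Injective)
    (hg : g.Injective) : ∃ e : V ≃ W, ∀ i, e (f i) = g i := by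
  let e₀ := Fintype.equivOfCardEq hcard
  obtain ⟨σ, hσ⟩ := Equiv.Perm.exists_extending_pair (e₀ ∘ f) g (e₀.injective.comp hf) hg
  exact ⟨e₀.trans σ, hσ⟩

/-- `G` is the star with centre `w` together with the edges `ab` and `cd`. -/
def IsStarWithEdges {V : Type*} (G : SimpleGraph V) (w a b c d : V) : Prop :=
  ∀ x y, G.Adj x y ↔ x ≠ y ∧ (x = w ∨ y = w ∨ s(x, y) = s(a, b) ∨ s(x, y) = s(c, d))

/-- An equivalence respecting the distinguished vertices is an isomorphism. -/
def IsStarWithEdges.iso {V W : Type*} {G : SimpleGraph V} {G' : SimpleGraph W} {w a b c d : V}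
    (e : V ≃ W) (h : IsStarWithEdges G w a b c d)
    (h' : IsStarWithEdges G' (e w) (e a) (e b) (e c) (e d)) : G ≃g G' where
  toEquiv := e
  map_rel_iff' := by
    intro x y
    rw [h, h']
    simp [e.injective.eq_iff]

lemma isStarWithEdges_fromRel {V : Type*} {r : V → V → Prop} {w a b c d : V}
    (h : ∀ x y, x ≠ y → ((r x y ∨ r y x) ↔ (x = w ∨ y = w ∨ (x = a ∧ y = b ∨ x = b ∧ y = a) ∨
      (x = c ∧ y = d ∨ x = d ∧ y = c)))) :
    IsStarWithEdges (SimpleGraph.fromRel r) w a b c d := by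
  intro x y
  rw [fromRel_adj, Sym2.eq_iff, Sym2.eq_iff]
  exact and_congr_right (h x y)

lemma isStarWithEdges_babGraph (m : ℕ) :
    IsStarWithEdges (BabGraph m 3) (.inl 0) (.inl 1) (.inl 2) (.inl 1) (.inl 3) := by
  refine isStarWithEdges_fromRel (V := Fin 4 ⊕ Fin (m - 3) ⊕ Fin (3 - 3)) (r := BabRel m 3) ?_
  rintro (i | i | i) (j | j | j)
  · simp only [BabRel, ne_eq, Sum.inl.injEq]
    revert i j
    decide
  all_goals first | exact i.elim0 | exact j.elim0 | simp [BabRel]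

lemma isStarWithEdges_bnmGraph (n : ℕ) :
    IsStarWithEdges (BnmGraph n 3) (.inl ()) (.inr (.inl 0)) (.inr (.inl 1)) (.inr (.inl 2))
      (.inr (.inl 3)) := by
  refine isStarWithEdges_fromRel
    (V := Unit ⊕ Fin 4 ⊕ Fin (n - 2 * 3 + 1) ⊕ (Fin (3 - 3) × Fin 2)) (r := BnmRel n 3) ?_
  rintro (i | i | i | ⟨i, -⟩) (j | j | j | ⟨j, -⟩)
  case inr.inl.inr.inl =>
    simp only [BnmRel, ne_eq, Sum.inr.injEq, Sum.inl.injEq, reduceCtorEq, false_or]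
    revert i j
    decide
  all_goals first | exact i.elim0 | exact j.elim0 | simp [BnmRel]

lemma card_babVert {n : ℕ} (hn : 4 ≤ n) : Fintype.card (BabVert (n - 1) 3) = n := by
  simp only [BabVert, Fintype.card_sum, Fintype.card_fin]
  omega

lemma card_bnmVert {n : ℕ} (hn : 6 ≤ n) : Fintype.card (BnmVert n 3) = n := by
  simp only [BnmVert, Fintype.card_sum, Fintype.card_prod, Fintype.card_fin, Fintype.card_unit]
  omega

section

variable {V : Type*} [Fintype V] {G : SimpleGraph V} {n : ℕ} {w a b c d : V}

lemma IsStarWithEdges.nonempty_iso_babGraph (h : IsStarWithEdges G w a b a c)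
    (hinj : Function.Injective ![w, a, b, c]) (hn : 4 ≤ n) (hcard : Fintype.card V = n) :
    Nonempty (G ≃g BabGraph (n - 1) 3) := by
  obtain ⟨e, he⟩ := exists_equiv_extending_pair (W := BabVert (n - 1) 3)
    (hcard.trans (card_babVert hn).symm) hinj (g := Sum.inl) Sum.inl_injective
  refine ⟨h.iso e ?_⟩
  rw [show e w = _ from he 0, show e a = _ from he 1, show e b = _ from he 2,
    show e c = _ from he 3]
  exact isStarWithEdges_babGraph _

lemma IsStarWithEdges.nonempty_iso_bnmGraph (h : IsStarWithEdges G w a b c d)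
    (hinj : Function.Injective ![w, a, b, c, d]) (hn : 6 ≤ n) (hcard : Fintype.card V = n) :
    Nonempty (G ≃g BnmGraph n 3) := by
  obtain ⟨e, he⟩ := exists_equiv_extending_pair (W := BnmVert n 3)
    (hcard.trans (card_bnmVert hn).symm) hinj
    (g := ![.inl (), .inr (.inl 0), .inr (.inl 1), .inr (.inl 2), .inr (.inl 3)])
    (show Function.Injective (β := Unit ⊕ Fin 4 ⊕ Fin (n - 2 * 3 + 1) ⊕ (Fin (3 - 3) × Fin 2)) _ by
      intro i j
      fin_cases i <;> fin_cases j <;> simp)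
  refine ⟨h.iso e ?_⟩
  rw [show e w = _ from he 0, show e a = _ from he 1, show e b = _ from he 2,
    show e c = _ from he 3, show e d = _ from he 4]
  exact isStarWithEdges_bnmGraph _

variable [DecidableEq V] [DecidableRel G.Adj]

lemma exists_isStarWithEdges (hcard : Fintype.card V = n) (hedges : G.edgeFinset.card = n + 1)
    (hw : G.degree w + 1 = n) :
    (∃ a b c, Function.Injective ![w, a, b, c] ∧ IsStarWithEdges G w a b a c) ∨
      ∃ a b c d, Function.Injective ![w, a, b, c, d] ∧ IsStarWithEdges G w a b c d := by
  have huniv : ∀ x, x ≠ w → G.Adj w x := by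
    have : G.neighborFinset w = Finset.univ.erase w := by
      refine Finset.eq_of_subset_of_card_le (fun x hx => ?_) ?_
      · simpa using (show G.Adj w x by simpa using hx).ne'
      · rw [Finset.card_erase_of_mem (Finset.mem_univ w), Finset.card_univ, hcard,
          card_neighborFinset_eq_degree]
        omega
    intro x hx
    rw [← mem_neighborFinset, this]
    simpa using hx
  have h2 : (G.deleteIncidenceSet w).edgeFinset.card = 2 := by
    rw [card_edgeFinset_deleteIncidenceSet]; omega
  obtain ⟨e₁, e₂, hne, he⟩ := Finset.card_eq_two.1 h2
  have hstar : ∀ a b c d, e₁ = s(a, b) → e₂ = s(c, d) → IsStarWithEdges G w a b c d := by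
    rintro a b c d rfl rfl x y
    by_cases hx : x = w
    · subst hx
      simpa using ⟨fun h => h.ne, fun h => huniv y (Ne.symm h)⟩
    by_cases hy : y = w
    · subst hy
      simpa using ⟨fun h => h.ne, fun h => (huniv x h).symm⟩
    have : s(x, y) ∈ (G.deleteIncidenceSet w).edgeFinset ↔ G.Adj x y := by
      simp [deleteIncidenceSet_adj, hx, hy]
    rw [← this, he]
    have hxy : s(x, y) ∈ ({s(a, b), s(c, d)} : Finset (Sym2 V)) → x ≠ y := by
      rw [← he, this]; exact fun h => h.ne
    simp only [Finset.mem_insert, Finset.mem_singleton] at hxy ⊢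
    tauto
  have hends : ∀ a b, s(a, b) ∈ (G.deleteIncidenceSet w).edgeFinset → a ≠ b ∧ a ≠ w ∧ b ≠ w := by
    intro a b hab
    have := deleteIncidenceSet_adj.1 (mem_edgeFinset.1 hab)
    exact ⟨this.1.ne, this.2⟩
  have hshared : ∀ a b c, e₁ = s(a, b) → e₂ = s(a, c) →
      ∃ a b c, Function.Injective ![w, a, b, c] ∧ IsStarWithEdges G w a b a c := by
    intro a b c h₁ h₂
    refine ⟨a, b, c, ?_, hstar _ _ _ _ h₁ h₂⟩
    have hab := hends a b (by simp [he, h₁])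
    have hac := hends a c (by simp [he, h₂])
    have hbc : b ≠ c := by rintro rfl; exact hne (h₁.trans h₂.symm)
    intro i j
    fin_cases i <;> fin_cases j <;> simp <;> grind
  induction e₁ with
  | _ a b =>
  induction e₂ with
  | _ c d =>
  by_cases hac : a = c
  · exact .inl (hshared a b d rfl (by rw [hac]))
  by_cases had : a = d
  · exact .inl (hshared a b c rfl (by rw [had, Sym2.eq_swap]))
  by_cases hbc : b = c
  · exact .inl (hshared b a d Sym2.eq_swap (by rw [hbc]))
  by_cases hbd : b = d
  · exact .inl (hshared b a c Sym2.eq_swap (by rw [hbd, Sym2.eq_swap]))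
  refine .inr ⟨a, b, c, d, ?_, hstar _ _ _ _ rfl rfl⟩
  have hab := hends a b (by simp [he])
  have hcd := hends c d (by simp [he])
  intro i j
  fin_cases i <;> fin_cases j <;> simp <;> grind

lemma IsStarWithEdges.neighborFinset_eq (h : IsStarWithEdges G w a b c d) :
    G.neighborFinset w = Finset.univ.erase w := by
  ext x
  simp [h w x, eq_comm]

lemma IsStarWithEdges.degree_add_one (h : IsStarWithEdges G w a b c d) :
    G.degree w + 1 = Fintype.card V := by
  rw [← card_neighborFinset_eq_degree, h.neighborFinset_eq,
    Finset.card_erase_add_one (Finset.mem_univ w), Finset.card_univ]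

lemma IsStarWithEdges.sumConn_eq (h : IsStarWithEdges G w a b c d)
    (hinj : Function.Injective ![w, a, b, c, d]) (hcard : Fintype.card V = n) :
    sumConn G = 4 / √((n : ℝ) + 1) + ((n : ℝ) - 5) / √n + 1 := by
  have hwa : w ≠ a := hinj.ne (show (0 : Fin 5) ≠ 1 by decide)
  have hwb : w ≠ b := hinj.ne (show (0 : Fin 5) ≠ 2 by decide)
  have hwc : w ≠ c := hinj.ne (show (0 : Fin 5) ≠ 3 by decide)
  have hwd : w ≠ d := hinj.ne (show (0 : Fin 5) ≠ 4 by decide)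
  have hab : a ≠ b := hinj.ne (show (1 : Fin 5) ≠ 2 by decide)
  have hac : a ≠ c := hinj.ne (show (1 : Fin 5) ≠ 3 by decide)
  have had : a ≠ d := hinj.ne (show (1 : Fin 5) ≠ 4 by decide)
  have hbc : b ≠ c := hinj.ne (show (2 : Fin 5) ≠ 3 by decide)
  have hbd : b ≠ d := hinj.ne (show (2 : Fin 5) ≠ 4 by decide)
  have hcd : c ≠ d := hinj.ne (show (3 : Fin 5) ≠ 4 by decide)
  have hNw := h.neighborFinset_eq
  have hn : 1 ≤ n := hcard ▸ Fintype.card_pos_iff.2 ⟨w⟩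
  have hdw : (G.degree w : ℝ) = n - 1 := by
    rw [eq_sub_iff_add_eq]
    exact_mod_cast h.degree_add_one.trans hcard
  have hedge : (G.deleteIncidenceSet w).edgeFinset = {s(a, b), s(c, d)} := by
    ext e
    induction e with
    | _ x y =>
      simp only [mem_edgeFinset, mem_edgeSet, deleteIncidenceSet_adj, h x y, Finset.mem_insert,
        Finset.mem_singleton, Sym2.eq_iff]
      grind
  have hdeg : ∀ x, x ≠ w → G.degree x = if x ∈ ({a, b, c, d} : Finset V) then 2 else 1 := by
    intro x hx
    have hadj : G.Adj w x := by simpa [h w x] using hx.symm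
    rw [← degree_deleteIncidenceSet_add G hx, if_pos hadj, ← card_incidenceFinset_eq_degree,
      incidenceFinset_eq_filter, hedge, Finset.filter_insert, Finset.filter_singleton]
    simp only [Sym2.mem_iff, Finset.mem_insert, Finset.mem_singleton]
    split_ifs <;> grind
  have hda : G.degree a = 2 := by rw [hdeg a hwa.symm]; simp
  have hdb : G.degree b = 2 := by rw [hdeg b hwb.symm]; simp
  have hdc : G.degree c = 2 := by rw [hdeg c hwc.symm]; simp
  have hdd : G.degree d = 2 := by rw [hdeg d hwd.symm]; simp
  have h4 : √(2 + 2 : ℝ) = 2 := by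
    rw [show (2 + 2 : ℝ) = 2 ^ 2 by norm_num, Real.sqrt_sq (by norm_num)]
  have hR : ∑ e ∈ (G.deleteIncidenceSet w).edgeFinset,
      1 / √(endSum (fun v => (G.degree v : ℝ)) e) = 1 := by
    rw [hedge, Finset.sum_pair (by simp [hac, had])]
    simp only [endSum_mk, hda, hdb, hdc, hdd, Nat.cast_ofNat, h4]
    norm_num
  have hN : ∑ v ∈ G.neighborFinset w, 1 / √(endSum (fun v => (G.degree v : ℝ)) s(w, v)) =
      4 / √((n : ℝ) + 1) + ((n : ℝ) - 5) / √n := by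
    have hsub : ({a, b, c, d} : Finset V) ⊆ Finset.univ.erase w := by
      intro x
      simp only [Finset.mem_insert, Finset.mem_singleton, Finset.mem_erase, Finset.mem_univ]
      grind
    have hc4 : ({a, b, c, d} : Finset V).card = 4 := by
      rw [Finset.card_insert_of_notMem (by simp [*]), Finset.card_insert_of_notMem (by simp [*]),
        Finset.card_pair hcd]
    have hc : ((Finset.univ.erase w \ {a, b, c, d} : Finset V).card : ℝ) = n - 5 := by
      rw [Finset.cast_card_sdiff hsub, hc4, Finset.card_erase_of_mem (Finset.mem_univ w),
        Finset.card_univ, hcard, Nat.cast_sub hn]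
      push_cast
      ring
    rw [hNw, ← Finset.sum_sdiff hsub, add_comm]
    congr 1
    · rw [Finset.sum_congr rfl (g := fun _ => 1 / √((n : ℝ) + 1)), Finset.sum_const, hc4]
      · simp; ring
      · intro x hx
        rw [endSum_mk, hdw, hdeg x (Finset.ne_of_mem_erase (hsub hx)), if_pos hx]
        congr 2; push_cast; ring
    · rw [Finset.sum_congr rfl (g := fun _ => 1 / √(n : ℝ)), Finset.sum_const, nsmul_eq_mul, hc]
      · ring
      · intro x hx
        rw [Finset.mem_sdiff] at hx
        rw [endSum_mk, hdw, hdeg x (Finset.ne_of_mem_erase hx.1), if_neg hx.2]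
        congr 2; push_cast; ring
  rw [sumConn_eq_sum_edgeFinset, sum_edgeFinset_eq_add G w, hN, hR]

end

/-- Let `n ≥ 8` and let `G` be a bicyclic graph with `n` vertices that is not
isomorphic to `B_n(n−1, 3)`. Then `χ(G) ≥ 4/√(n+1) + (n−5)/√n + 1`, with equality
if and only if `G ≅ B_{n,3}`. -/
theorem stmt_11 {V : Type*} [Fintype V] (G : SimpleGraph V) (n : ℕ) (hn : 8 ≤ n)
    (hcard : Fintype.card V = n) (hconn : G.Connected)
    (hedges : G.edgeSet.ncard = n + 1)
    (hnot : ¬ Nonempty (G ≃g BabGraph (n - 1) 3)) :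
    sumConn G ≥ 4 / Real.sqrt ((n : ℝ) + 1) + ((n : ℝ) - 5) / Real.sqrt (n : ℝ) + 1 ∧
    (sumConn G = 4 / Real.sqrt ((n : ℝ) + 1) + ((n : ℝ) - 5) / Real.sqrt (n : ℝ) + 1 ↔
      Nonempty (G ≃g BnmGraph n 3)) := by
  classical
  have hedges' : G.edgeFinset.card = n + 1 := by
    rw [← hedges, Set.ncard_eq_toFinset_card', edgeFinset]
  have : Nontrivial V := Fintype.one_lt_card_iff_nontrivial.1 (by omega)
  have hpos : ∀ v, 0 < G.degree v := fun v => hconn.preconnected.degree_pos_of_nontrivial v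
  by_cases hstar : ∃ w, G.degree w + 1 = n
  · obtain ⟨w, hw⟩ := hstar
    obtain ⟨a, b, c, hinj, h⟩ | ⟨a, b, c, d, hinj, h⟩ := exists_isStarWithEdges hcard hedges' hw
    · exact absurd (h.nonempty_iso_babGraph hinj (by omega) hcard) hnot
    · have hsum := h.sumConn_eq hinj hcard
      exact ⟨hsum.ge, fun _ => h.nonempty_iso_bnmGraph hinj (by omega) hcard, fun _ => hsum⟩
  · have hlt : secondMin n < sumConn G := by
      have := Classical.arbitrary V
      obtain ⟨w, hw⟩ := G.exists_maximal_degree_vertex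
      have hmax : ∀ v, G.degree v ≤ G.degree w := fun v => hw ▸ G.degree_le_maxDegree v
      have hwn : G.degree w < n := hcard ▸ G.degree_lt_card_verts w
      have hwn' : G.degree w + 1 ≠ n := fun h => hstar ⟨w, h⟩
      obtain hd | hd := le_or_gt (2 * G.degree w) n
      · exact (secondMin_lt_of_two_mul_le hn hd).trans_le
          (sqrt_le_sumConn_of_degree_le G hcard hedges' hpos hmax)
      · exact (secondMin_lt_of_lt_two_mul hn hd (by omega)).trans_le
          (sqrt_add_sqrt_le_sumConn G hcard hedges' hpos rfl)
    rw [secondMin] at hlt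
    refine ⟨hlt.le, fun h => absurd h hlt.ne', fun ⟨e⟩ => (hstar ?_).elim⟩
    obtain ⟨x, hx⟩ : ∃ x : BnmVert n 3, (BnmGraph n 3).degree x + 1 = n :=
      ⟨_, (isStarWithEdges_bnmGraph n).degree_add_one.trans (card_bnmVert (by omega))⟩
    exact ⟨e.symm x, by rw [e.symm.degree_eq, hx]⟩
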